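/- arXiv:2504.13485 — 2 statements merged into one kernel-verified Lean document; each statement's English description precedes it below -/
import Mathlib

section
/- For each sign ε ∈ {+, −}, the map g is injective on the set D_ε = {ξ ∈ ℝ^d : ‖ξ‖ < 1 and ε⟨σ(ξ), a⟩ > 0}: if ξ₁, ξ₂ ∈ D_ε and g(ξ₁) = g(ξ₂) then ξ₁ = ξ₂. -/
open Matrix

noncomputable section

/-- `f ξ = √(1 - ‖ξ‖²)` (Euclidean norm, written via the dot product). -/
def fH {d : ℕ} (ξ : Fin d → ℝ) : ℝ := Real.sqrt (1 - ξ ⬝ᵥ ξ)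

/-- `σ ξ = (f ξ, ξ) ∈ ℝ^{1+d}`. -/
def sigmaH {d : ℕ} (ξ : Fin d → ℝ) : Fin (d + 1) → ℝ := Fin.cons (fH ξ) ξ

/-- `π (x₀, x) = x`. -/
def piH {d : ℕ} (z : Fin (d + 1) → ℝ) : Fin d → ℝ := fun i => z i.succ

/-- `e₀ = (1, 0, …, 0)`. -/
def e0H {d : ℕ} : Fin (d + 1) → ℝ := fun i => if i = 0 then 1 else 0

/-- the lower-right `d × d` block of `G`. -/
def G0H {d : ℕ} (G : Matrix (Fin (d + 1)) (Fin (d + 1)) ℝ) : Matrix (Fin d) (Fin d) ℝ :=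
  fun i j => G i.succ j.succ

/-- `b = π (Gᵀ e₀)`. -/
def bH {d : ℕ} (G : Matrix (Fin (d + 1)) (Fin (d + 1)) ℝ) : Fin d → ℝ :=
  piH (Gᵀ.mulVec e0H)

/-- `g ξ = π (Gᵀ σ(ξ))`. -/
def gH {d : ℕ} (G : Matrix (Fin (d + 1)) (Fin (d + 1)) ℝ) (ξ : Fin d → ℝ) : Fin d → ℝ :=
  piH (Gᵀ.mulVec (sigmaH ξ))

/-- `a = (Gᵀ)⁻¹ e₀`. -/
def aH {d : ℕ} (G : Matrix (Fin (d + 1)) (Fin (d + 1)) ℝ) : Fin (d + 1) → ℝ :=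
  (Gᵀ)⁻¹.mulVec e0H

/-- The matrix of the linear map `M(ξ) : v ↦ G₀ᵀ v - (⟨ξ, v⟩ / f ξ) • b`. -/
def MH {d : ℕ} (G : Matrix (Fin (d + 1)) (Fin (d + 1)) ℝ) (ξ : Fin d → ℝ) :
    Matrix (Fin d) (Fin d) ℝ :=
  (G0H G)ᵀ - (fH ξ)⁻¹ • vecMulVec (bH G) ξ

/-- Points of the unit ball lift to the unit sphere. -/
theorem sigmaH_dotProduct_self {d : ℕ} {ξ : Fin d → ℝ} (h : ξ ⬝ᵥ ξ ≤ 1) :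
    sigmaH ξ ⬝ᵥ sigmaH ξ = 1 := by
  have hsq : fH ξ * fH ξ = 1 - ξ ⬝ᵥ ξ := Real.mul_self_sqrt (sub_nonneg.mpr h)
  have hdot : sigmaH ξ ⬝ᵥ sigmaH ξ = fH ξ * fH ξ + ξ ⬝ᵥ ξ := by
    simp [dotProduct, sigmaH, Fin.sum_univ_succ]
  rw [hdot, hsq, sub_add_cancel]

theorem sigmaH_injective {d : ℕ} : Function.Injective (sigmaH (d := d)) :=
  fun _ _ h => (Fin.cons_inj.mp h).2

theorem eq_smul_e0H_of_piH_eq_zero {d : ℕ} {z : Fin (d + 1) → ℝ} (h : piH z = 0) :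
    z = z 0 • e0H := by
  funext i
  refine Fin.cases ?_ (fun j => ?_) i
  · simp [e0H]
  · simpa [e0H, piH] using congrFun h j

/-- The fibres of `g` lie, after lifting by `σ`, on lines with direction `a`. -/
theorem exists_sigmaH_sub_eq_smul_aH {d : ℕ} {G : Matrix (Fin (d + 1)) (Fin (d + 1)) ℝ}
    (hG : IsUnit G.det) {ξ η : Fin d → ℝ} (h : gH G ξ = gH G η) :
    ∃ t : ℝ, sigmaH ξ - sigmaH η = t • aH G := by
  have hdet : IsUnit (Gᵀ).det := by rwa [det_transpose]
  have hpi : piH (Gᵀ *ᵥ (sigmaH ξ - sigmaH η)) = 0 := by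
    rw [mulVec_sub]
    funext i
    exact sub_eq_zero.mpr (congrFun h i)
  refine ⟨(Gᵀ *ᵥ (sigmaH ξ - sigmaH η)) 0, ?_⟩
  rw [aH, ← mulVec_smul, ← eq_smul_e0H_of_piH_eq_zero hpi, mulVec_mulVec,
    nonsing_inv_mul _ hdet, one_mulVec]

/-- `g` is injective on each of the sets `D_ε = {ξ : ‖ξ‖ < 1, ε⟨σ(ξ), a⟩ > 0}`,
`ε = ±1`. -/
theorem stmt_7 (d : ℕ) (hd : 1 ≤ d) (G : Matrix (Fin (d + 1)) (Fin (d + 1)) ℝ)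
    (hG : IsUnit G.det) (ε : ℝ) (hε : ε = 1 ∨ ε = -1) :
    Set.InjOn (gH G) {ξ : Fin d → ℝ | ξ ⬝ᵥ ξ < 1 ∧ 0 < ε * (sigmaH ξ ⬝ᵥ aH G)} := by
  rintro ξ ⟨hξ, hξa⟩ η ⟨hη, hηa⟩ h
  obtain ⟨t, ht⟩ := exists_sigmaH_sub_eq_smul_aH hG h
  have horth : (sigmaH ξ + sigmaH η) ⬝ᵥ (sigmaH ξ - sigmaH η) = 0 := by
    rw [dotProduct_sub, add_dotProduct, add_dotProduct, sigmaH_dotProduct_self hξ.le,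
      sigmaH_dotProduct_self hη.le, dotProduct_comm (sigmaH η) (sigmaH ξ)]
    ring
  rw [ht, dotProduct_smul, add_dotProduct, smul_eq_mul] at horth
  have hsum : sigmaH ξ ⬝ᵥ aH G + sigmaH η ⬝ᵥ aH G ≠ 0 := by
    intro h0
    have hpos := add_pos hξa hηa
    rw [← mul_add, h0, mul_zero] at hpos
    exact hpos.false
  have ht0 : t = 0 := (mul_eq_zero.mp horth).resolve_right hsum
  rw [ht0, zero_smul, sub_eq_zero] at ht
  exact sigmaH_injective ht

end
end

section
/- (Ray lemma, linear case.) Let ξ_A ∈ ℝ^d with ‖ξ_A‖ < 1, let x_B ∈ ℝ^d, and set x_A := M(ξ_A)ᵀ x_B (i.e. x_A = G₀ x_B − (⟨b, x_B⟩ / f(ξ_A)) ξ_A). Set A := (0, x_A) ∈ ℝ^{1+d} and B := G·(0, x_B) ∈ ℝ^{1+d}. Then B − A = (⟨b, x_B⟩ / f(ξ_A)) σ(ξ_A); in particular B − A is collinear to σ(ξ_A). -/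
open Matrix

noncomputable section

theorem fH_pos {d : ℕ} {ξ : Fin d → ℝ} (h : ξ ⬝ᵥ ξ < 1) : 0 < fH ξ :=
  Real.sqrt_pos.2 (sub_pos.2 h)

theorem bH_apply {d : ℕ} (G : Matrix (Fin (d + 1)) (Fin (d + 1)) ℝ) (j : Fin d) :
    bH G j = G 0 j.succ := by
  simp [bH, piH, e0H, mulVec, dotProduct]

theorem MH_transpose_mulVec {d : ℕ} (G : Matrix (Fin (d + 1)) (Fin (d + 1)) ℝ)
    (ξ x : Fin d → ℝ) :
    (MH G ξ)ᵀ.mulVec x = (G0H G).mulVec x - (bH G ⬝ᵥ x / fH ξ) • ξ := by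
  rw [MH, transpose_sub, transpose_transpose, transpose_smul, transpose_vecMulVec,
    sub_mulVec, smul_mulVec, vecMulVec_mulVec]
  ext i
  simp [div_eq_mul_inv]
  ring

theorem mulVec_cons_zero {d : ℕ} (G : Matrix (Fin (d + 1)) (Fin (d + 1)) ℝ) (x : Fin d → ℝ) :
    G.mulVec (Fin.cons 0 x) = Fin.cons (bH G ⬝ᵥ x) ((G0H G).mulVec x) := by
  ext i
  refine Fin.cases ?_ (fun i => ?_) i <;>
    simp [mulVec, dotProduct, Fin.sum_univ_succ, bH_apply, G0H]

theorem mulVec_cons_zero_sub {d : ℕ} (G : Matrix (Fin (d + 1)) (Fin (d + 1)) ℝ)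
    {ξ : Fin d → ℝ} (hξ : ξ ⬝ᵥ ξ < 1) (x : Fin d → ℝ) :
    G.mulVec (Fin.cons 0 x) - Fin.cons 0 ((MH G ξ)ᵀ.mulVec x)
      = (bH G ⬝ᵥ x / fH ξ) • sigmaH ξ := by
  have hf := (fH_pos hξ).ne'
  rw [mulVec_cons_zero, MH_transpose_mulVec]
  ext i
  refine Fin.cases ?_ (fun i => ?_) i <;> simp [sigmaH, hf]

/-- Ray lemma, linear case: with `x_A = M(ξ_A)ᵀ x_B` (i.e.
`x_A = G₀ x_B − (⟨b, x_B⟩/f(ξ_A)) ξ_A`), `A = (0, x_A)` and `B = G·(0, x_B)`,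
one has `B − A = (⟨b, x_B⟩ / f(ξ_A)) σ(ξ_A)`; in particular `B − A` is collinear
to `σ(ξ_A)`. -/
theorem stmt_15 (d : ℕ) (hd : 1 ≤ d) (G : Matrix (Fin (d + 1)) (Fin (d + 1)) ℝ)
    (hG : IsUnit G.det) (ξA : Fin d → ℝ) (hξA : ξA ⬝ᵥ ξA < 1) (xB : Fin d → ℝ) :
    ((MH G ξA)ᵀ.mulVec xB = (G0H G).mulVec xB - (bH G ⬝ᵥ xB / fH ξA) • ξA) ∧
    (G.mulVec (Fin.cons 0 xB) - Fin.cons 0 ((MH G ξA)ᵀ.mulVec xB)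
        = (bH G ⬝ᵥ xB / fH ξA) • sigmaH ξA) ∧
    ∃ l : ℝ, G.mulVec (Fin.cons 0 xB) - Fin.cons 0 ((MH G ξA)ᵀ.mulVec xB)
        = l • sigmaH ξA := by
  exact ⟨MH_transpose_mulVec G ξA xB, mulVec_cons_zero_sub G hξA xB,
    _, mulVec_cons_zero_sub G hξA xB⟩

end
end
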